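/- ICPDL, CPDL(TW₁) and CPDL(TW₂) are equi-expressive, via polynomial time translations: formulas (resp. programs) of ICPDL, of CPDL(TW₁), and of CPDL(TW₂) define exactly the same unary (resp. binary) relations. -/

import Mathlib

set_option linter.unusedVariables false

/-! ## Kripke structures -/

/-- A Kripke structure with worlds `W`, atomic propositions `P` and atomic programs `A`. -/
structure Kripke (W P A : Type) where
  rel : A → W → W → Prop
  val : P → W → Prop

/-! ## Syntax of `CPDL+` with loop and intersection (master language) -/

mutual
  /-- Formulas of loop/intersection CPDL+:  `p | ¬φ | φ∧φ | ⟨π⟩ | loop(π)`. -/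
  inductive PDLFormula : Type where
    | prop  : ℕ → PDLFormula
    | neg   : PDLFormula → PDLFormula
    | conj  : PDLFormula → PDLFormula → PDLFormula
    | diam  : PDLProgram → PDLFormula
    | floop : PDLProgram → PDLFormula
  /-- Programs: `ε | a | ā | π∪π | π∘π | π* | φ? | π∩π | C[x_s,x_t]`. -/
  inductive PDLProgram : Type where
    | eps    : PDLProgram
    | atom   : ℕ → PDLProgram
    | conv   : ℕ → PDLProgram
    | punion : PDLProgram → PDLProgram → PDLProgram
    | comp   : PDLProgram → PDLProgram → PDLProgram
    | star   : PDLProgram → PDLProgram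
    | test   : PDLFormula → PDLProgram
    | inter  : PDLProgram → PDLProgram → PDLProgram
    | cprog  : AtomList → ℕ → ℕ → PDLProgram
  /-- A finite list of atoms `π(x,y)` (a "conjunctive program body" `C`). -/
  inductive AtomList : Type where
    | nil   : AtomList
    | acons : PDLProgram → ℕ → ℕ → AtomList → AtomList
end

/-! ## Semantics -/

mutual
  /-- Satisfaction `⟦φ⟧_K ⊆ W`. -/
  def PDLFormula.sat {W : Type} (K : Kripke W ℕ ℕ) : PDLFormula → W → Prop
    | .prop p, w => K.val p w
    | .neg φ, w => ¬ PDLFormula.sat K φ w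
    | .conj φ ψ, w => PDLFormula.sat K φ w ∧ PDLFormula.sat K ψ w
    | .diam π, w => ∃ v, PDLProgram.rel K π w v
    | .floop π, w => PDLProgram.rel K π w w
  termination_by φ _ => sizeOf φ
  /-- Binary relation `⟦π⟧_K ⊆ W × W`. -/
  def PDLProgram.rel {W : Type} (K : Kripke W ℕ ℕ) : PDLProgram → W → W → Prop
    | .eps, u, v => u = v
    | .atom a, u, v => K.rel a u v
    | .conv a, u, v => K.rel a v u
    | .punion π ρ, u, v => PDLProgram.rel K π u v ∨ PDLProgram.rel K ρ u v
    | .comp π ρ, u, v => ∃ w, PDLProgram.rel K π u w ∧ PDLProgram.rel K ρ w v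
    | .star π, u, v => Relation.ReflTransGen (fun a b => PDLProgram.rel K π a b) u v
    | .test φ, u, v => u = v ∧ PDLFormula.sat K φ u
    | .inter π ρ, u, v => PDLProgram.rel K π u v ∧ PDLProgram.rel K ρ u v
    | .cprog C xs xt, u, v => ∃ f : ℕ → W, f xs = u ∧ f xt = v ∧ AtomList.sat K C f
  termination_by π _ _ => sizeOf π
  /-- `f` is a `C`-satisfying assignment. -/
  def AtomList.sat {W : Type} (K : Kripke W ℕ ℕ) : AtomList → (ℕ → W) → Prop
    | .nil, _ => True
    | .acons π x y C, f => PDLProgram.rel K π (f x) (f y) ∧ AtomList.sat K C f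
  termination_by C _ => sizeOf C
end

/-- Semantic equivalence of formulas (on every Kripke structure). -/
def FormEquiv (φ ψ : PDLFormula) : Prop :=
  ∀ (W : Type) (K : Kripke W ℕ ℕ) (w : W), φ.sat K w ↔ ψ.sat K w

/-- Semantic equivalence of programs (on every Kripke structure). -/
def ProgEquiv (π ρ : PDLProgram) : Prop :=
  ∀ (W : Type) (K : Kripke W ℕ ℕ) (u v : W), π.rel K u v ↔ ρ.rel K u v

/-! ## Graphs (undirected, possibly with self-loops), tree decompositions -/

/-- An undirected graph (self-loop edges are allowed; `adj` is intended symmetric). -/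
structure UGraph (V : Type) where
  verts : Set V
  adj : V → V → Prop

/-- Connectedness of a graph. -/
def UGraph.Connected {V : Type} (G : UGraph V) : Prop :=
  G.verts.Nonempty ∧ ∀ x ∈ G.verts, ∀ y ∈ G.verts, Relation.ReflTransGen G.adj x y

/-- Graph isomorphism (between graphs on possibly different vertex types). -/
def UGraph.Iso {V V' : Type} (G : UGraph V) (H : UGraph V') : Prop :=
  ∃ f : V → V', Set.BijOn f G.verts H.verts ∧
    ∀ x ∈ G.verts, ∀ y ∈ G.verts, (G.adj x y ↔ H.adj (f x) (f y))

/-- A tree decomposition of a (possibly infinite) graph. -/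
structure TreeDecomp {V : Type} (G : UGraph V) where
  ι : Type
  T : SimpleGraph ι
  isTree : T.IsTree
  bag : ι → Set V
  cov_vert : ∀ v ∈ G.verts, ∃ b, v ∈ bag b
  cov_edge : ∀ x y, G.adj x y → ∃ b, x ∈ bag b ∧ y ∈ bag b
  conn : ∀ (v : V) (b b' : ι), v ∈ bag b → v ∈ bag b' →
    Relation.ReflTransGen (fun c c' => T.Adj c c' ∧ v ∈ bag c ∧ v ∈ bag c') b b'

/-- The decomposition has width ≤ k (all bags have at most k+1 elements). -/
def TreeDecomp.WidthLE {V : Type} {G : UGraph V} (td : TreeDecomp G) (k : ℕ) : Prop :=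
  ∀ b, (td.bag b).Finite ∧ (td.bag b).ncard ≤ k + 1

/-- The graph has tree-width ≤ k. -/
def UGraph.TreewidthLE {V : Type} (G : UGraph V) (k : ℕ) : Prop :=
  ∃ td : TreeDecomp G, td.WidthLE k

/-- `TWₖ`: the class of finite graphs of tree-width at most `k`. -/
def TWClass (k : ℕ) : Set (UGraph ℕ) :=
  {G | G.verts.Finite ∧ G.TreewidthLE k}

/-! ## Underlying graphs of conjunctive programs, fragments -/

/-- The list of atoms `(π, x, y)` of `C`. -/
def AtomList.toList : AtomList → List (PDLProgram × ℕ × ℕ)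
  | .nil => []
  | .acons π x y C => (π, x, y) :: C.toList

/-- The variables occurring in `C`. -/
def AtomList.vars (C : AtomList) : Set ℕ :=
  {z | ∃ e ∈ C.toList, z = e.2.1 ∨ z = e.2.2}

/-- The underlying graph `G_C` of a set of atoms `C`. -/
def AtomList.graphC (C : AtomList) : UGraph ℕ where
  verts := C.vars
  adj x y := ∃ e ∈ C.toList, (x = e.2.1 ∧ y = e.2.2) ∨ (x = e.2.2 ∧ y = e.2.1)

/-- The underlying graph `G_{C[x_s,x_t]}`: `G_C` together with the edge `{x_s,x_t}`. -/
def cprogGraph (C : AtomList) (xs xt : ℕ) : UGraph ℕ where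
  verts := C.vars
  adj x y := C.graphC.adj x y ∨ (x = xs ∧ y = xt) ∨ (x = xt ∧ y = xs)

mutual
  /-- Syntactic fragment predicate: `L` allows `loop`, `I` allows `∩`, `N` allows `¬`,
  and every conjunctive program must be well-formed with underlying graph in
  (isomorphic to a member of) the class `𝒢`. -/
  def PDLFormula.OK (L I N : Bool) (𝒢 : Set (UGraph ℕ)) : PDLFormula → Prop
    | .prop _ => True
    | .neg φ => N = true ∧ PDLFormula.OK L I N 𝒢 φ
    | .conj φ ψ => PDLFormula.OK L I N 𝒢 φ ∧ PDLFormula.OK L I N 𝒢 ψ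
    | .diam π => PDLProgram.OK L I N 𝒢 π
    | .floop π => L = true ∧ PDLProgram.OK L I N 𝒢 π
  def PDLProgram.OK (L I N : Bool) (𝒢 : Set (UGraph ℕ)) : PDLProgram → Prop
    | .eps => True
    | .atom _ => True
    | .conv _ => True
    | .punion π ρ => PDLProgram.OK L I N 𝒢 π ∧ PDLProgram.OK L I N 𝒢 ρ
    | .comp π ρ => PDLProgram.OK L I N 𝒢 π ∧ PDLProgram.OK L I N 𝒢 ρ
    | .star π => PDLProgram.OK L I N 𝒢 π
    | .test φ => PDLFormula.OK L I N 𝒢 φ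
    | .inter π ρ => I = true ∧ PDLProgram.OK L I N 𝒢 π ∧ PDLProgram.OK L I N 𝒢 ρ
    | .cprog C xs xt =>
        xs ∈ C.vars ∧ xt ∈ C.vars ∧ (C.graphC).Connected ∧
        (∃ H ∈ 𝒢, (cprogGraph C xs xt).Iso H) ∧ AtomList.OK L I N 𝒢 C
  def AtomList.OK (L I N : Bool) (𝒢 : Set (UGraph ℕ)) : AtomList → Prop
    | .nil => True
    | .acons π _ _ C => PDLProgram.OK L I N 𝒢 π ∧ AtomList.OK L I N 𝒢 C
end

/-- The class of all graphs (no restriction on conjunctive programs). -/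
def FullClass : Set (UGraph ℕ) := Set.univ

/-- The single-vertex graph with a self-loop. -/
def loopGraph : UGraph ℕ := ⟨{0}, fun x y => x = 0 ∧ y = 0⟩

/-- The two-vertex graph with one edge. -/
def capGraph : UGraph ℕ := ⟨{0, 1}, fun x y => (x = 0 ∧ y = 1) ∨ (x = 1 ∧ y = 0)⟩

def GraphLoopClass : Set (UGraph ℕ) := {loopGraph}
def GraphCapClass : Set (UGraph ℕ) := {capGraph}

/-- `CPDL+` formulas: no loop, no intersection, arbitrary conjunctive programs. -/
def IsCPDLPlusFormula (φ : PDLFormula) : Prop := PDLFormula.OK false false true FullClass φ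
def IsCPDLPlusProgram (π : PDLProgram) : Prop := PDLProgram.OK false false true FullClass π
/-- `ICPDL+` formulas: intersection plus arbitrary conjunctive programs. -/
def IsICPDLPlusFormula (φ : PDLFormula) : Prop := PDLFormula.OK false true true FullClass φ
def IsICPDLPlusProgram (π : PDLProgram) : Prop := PDLProgram.OK false true true FullClass π
/-- `ICPDL` formulas: intersection, no conjunctive programs. -/
def IsICPDLFormula (φ : PDLFormula) : Prop := PDLFormula.OK false true true ∅ φ
def IsICPDLProgram (π : PDLProgram) : Prop := PDLProgram.OK false true true ∅ π

/-! ## Underlying graph / tree-width of Kripke structures -/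

/-- `u` is at distance ≤ 1 from `v` in (the underlying undirected graph of) `K`. -/
def Kripke.Near {W P A : Type} (K : Kripke W P A) (u v : W) : Prop :=
  u = v ∨ ∃ a, K.rel a u v ∨ K.rel a v u

/-- The underlying undirected graph of a Kripke structure. -/
def Kripke.graph {W P A : Type} (K : Kripke W P A) : UGraph W :=
  ⟨Set.univ, fun u v => ∃ a, K.rel a u v ∨ K.rel a v u⟩

/-- A Kripke structure has tree-width ≤ k. -/
def Kripke.TreewidthLE {W P A : Type} (K : Kripke W P A) (k : ℕ) : Prop :=
  K.graph.TreewidthLE k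

/-- Every world has finitely many neighbours at distance ≤ 1. -/
def Kripke.FiniteDegree {W P A : Type} (K : Kripke W P A) : Prop :=
  ∀ u : W, {v | K.Near u v}.Finite


/-- There is a polynomial-time (here: polynomial-size, equivalence-preserving) translation
from formulas satisfying `F₁` to formulas satisfying `F₂` and from programs satisfying `P₁`
to programs satisfying `P₂`. -/
def PolyTrans (F₁ F₂ : PDLFormula → Prop) (P₁ P₂ : PDLProgram → Prop) : Prop :=
  ∃ (trF : PDLFormula → PDLFormula) (trP : PDLProgram → PDLProgram) (c : ℕ),
    (∀ φ, F₁ φ → F₂ (trF φ) ∧ FormEquiv φ (trF φ) ∧ sizeOf (trF φ) ≤ (sizeOf φ + c) ^ c) ∧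
    (∀ π, P₁ π → P₂ (trP π) ∧ ProgEquiv π (trP π) ∧ sizeOf (trP π) ≤ (sizeOf π + c) ^ c)

/-- `CPDL(TWₖ)` formulas. -/
def CPDLTWFormula (k : ℕ) : PDLFormula → Prop := PDLFormula.OK false false true (TWClass k)
/-- `CPDL(TWₖ)` programs. -/
def CPDLTWProgram (k : ℕ) : PDLProgram → Prop := PDLProgram.OK false false true (TWClass k)

/-! ## Reversal -/

def PDLProgram.rev : PDLProgram → PDLProgram
  | .eps => .eps
  | .atom a => .conv a
  | .conv a => .atom a
  | .punion π ρ => .punion π.rev ρ.rev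
  | .comp π ρ => .comp ρ.rev π.rev
  | .star π => .star π.rev
  | .test φ => .test φ
  | .inter π ρ => .inter π.rev ρ.rev
  | .cprog C x y => .cprog C y x

theorem rev_spec : ∀ (π : PDLProgram), IsICPDLProgram π →
    IsICPDLProgram π.rev ∧ sizeOf π.rev = sizeOf π ∧
    ∀ (W : Type) (K : Kripke W ℕ ℕ) (u v : W), π.rev.rel K u v ↔ π.rel K v u
  | .eps, _ => by
    simp [PDLProgram.rev, PDLProgram.rel, IsICPDLProgram, PDLProgram.OK, eq_comm]
  | .atom a, _ => by
    simp [PDLProgram.rev, PDLProgram.rel, IsICPDLProgram, PDLProgram.OK]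
  | .conv a, _ => by
    simp [PDLProgram.rev, PDLProgram.rel, IsICPDLProgram, PDLProgram.OK]
  | .punion π ρ, h => by
    simp only [IsICPDLProgram, PDLProgram.OK] at h
    obtain ⟨a1, a2, a3⟩ := rev_spec π h.1
    obtain ⟨b1, b2, b3⟩ := rev_spec ρ h.2
    refine ⟨?_, ?_, ?_⟩
    · simp only [IsICPDLProgram, PDLProgram.rev, PDLProgram.OK]; exact ⟨a1, b1⟩
    · simp [PDLProgram.rev, a2, b2]
    · intro W K u v; simp [PDLProgram.rev, PDLProgram.rel, a3, b3]
  | .comp π ρ, h => by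
    simp only [IsICPDLProgram, PDLProgram.OK] at h
    obtain ⟨a1, a2, a3⟩ := rev_spec π h.1
    obtain ⟨b1, b2, b3⟩ := rev_spec ρ h.2
    refine ⟨?_, ?_, ?_⟩
    · simp only [IsICPDLProgram, PDLProgram.rev, PDLProgram.OK]; exact ⟨b1, a1⟩
    · simp [PDLProgram.rev, a2, b2]; omega
    · intro W K u v; simp [PDLProgram.rev, PDLProgram.rel, a3, b3, and_comm]
  | .inter π ρ, h => by
    simp only [IsICPDLProgram, PDLProgram.OK] at h
    obtain ⟨a1, a2, a3⟩ := rev_spec π h.2.1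
    obtain ⟨b1, b2, b3⟩ := rev_spec ρ h.2.2
    refine ⟨?_, ?_, ?_⟩
    · simp only [IsICPDLProgram, PDLProgram.rev, PDLProgram.OK]; exact ⟨trivial, a1, b1⟩
    · simp [PDLProgram.rev, a2, b2]
    · intro W K u v; simp [PDLProgram.rev, PDLProgram.rel, a3, b3]
  | .star π, h => by
    simp only [IsICPDLProgram, PDLProgram.OK] at h
    obtain ⟨a1, a2, a3⟩ := rev_spec π h
    refine ⟨?_, ?_, ?_⟩
    · simp only [IsICPDLProgram, PDLProgram.rev, PDLProgram.OK]; exact a1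
    · simp [PDLProgram.rev, a2]
    · intro W K u v
      simp only [PDLProgram.rev, PDLProgram.rel, a3]
      exact Relation.reflTransGen_swap
  | .test φ, h => by
    refine ⟨by simpa [PDLProgram.rev] using h, by simp [PDLProgram.rev], ?_⟩
    intro W K u v
    simp only [PDLProgram.rev, PDLProgram.rel]
    constructor <;> (rintro ⟨rfl, h⟩; exact ⟨rfl, h⟩)
  | .cprog C x y, h => by
    simp [IsICPDLProgram, PDLProgram.OK] at h

/-! ## Lists of atoms -/

def LSat {W : Type} (K : Kripke W ℕ ℕ) (L : List (PDLProgram × ℕ × ℕ)) (f : ℕ → W) : Prop :=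
  ∀ e ∈ L, e.1.rel K (f e.2.1) (f e.2.2)

def LAdj (L : List (PDLProgram × ℕ × ℕ)) (x y : ℕ) : Prop :=
  ∃ e ∈ L, (x = e.2.1 ∧ y = e.2.2) ∨ (x = e.2.2 ∧ y = e.2.1)

noncomputable def mu (L : List (PDLProgram × ℕ × ℕ)) : ℕ := (L.map (fun e => sizeOf e.1 + 3)).sum

def LOK (L : List (PDLProgram × ℕ × ℕ)) : Prop := ∀ e ∈ L, IsICPDLProgram e.1

theorem LAdj.symm {L : List (PDLProgram × ℕ × ℕ)} {x y : ℕ} (h : LAdj L x y) : LAdj L y x := by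
  obtain ⟨e, he, h | h⟩ := h
  · exact ⟨e, he, Or.inr ⟨h.2, h.1⟩⟩
  · exact ⟨e, he, Or.inl ⟨h.2, h.1⟩⟩

theorem mu_append (L M : List (PDLProgram × ℕ × ℕ)) : mu (L ++ M) = mu L + mu M := by
  simp [mu]

theorem mu_cons (e : PDLProgram × ℕ × ℕ) (M : List (PDLProgram × ℕ × ℕ)) :
    mu (e :: M) = sizeOf e.1 + 3 + mu M := by
  simp [mu]

theorem mu_filter (p : PDLProgram × ℕ × ℕ → Prop) [DecidablePred p]
    (L : List (PDLProgram × ℕ × ℕ)) :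
    mu L = mu (L.filter (fun e => decide (p e))) + mu (L.filter (fun e => decide (¬ p e))) := by
  induction L with
  | nil => simp [mu]
  | cons e L ih =>
    by_cases h : p e
    · simp [List.filter_cons, h, mu_cons] at ih ⊢; omega
    · simp [List.filter_cons, h, mu_cons] at ih ⊢; omega

theorem absorb (x y : ℕ) : ∀ (L : List (PDLProgram × ℕ × ℕ)) (ρ : PDLProgram),
    IsICPDLProgram ρ → LOK L →
    (∀ e ∈ L, (e.2.1 = x ∨ e.2.1 = y) ∧ (e.2.2 = x ∨ e.2.2 = y)) →
    ∃ ρ', IsICPDLProgram ρ' ∧ sizeOf ρ' ≤ sizeOf ρ + mu L ∧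
      ∀ (W : Type) (K : Kripke W ℕ ℕ) (f : ℕ → W),
        ρ'.rel K (f x) (f y) ↔ ρ.rel K (f x) (f y) ∧ LSat K L f
  | [], ρ, hρ, _, _ => ⟨ρ, hρ, by simp [mu], by simp [LSat]⟩
  | (π, a, b) :: L, ρ, hρ, hL, he => by
    have hπ : IsICPDLProgram π := hL _ (List.mem_cons_self ..)
    have key : ∃ σ, IsICPDLProgram σ ∧ sizeOf σ ≤ sizeOf ρ + (sizeOf π + 3) ∧
      ∀ (W : Type) (K : Kripke W ℕ ℕ) (f : ℕ → W),
        σ.rel K (f x) (f y) ↔ ρ.rel K (f x) (f y) ∧ π.rel K (f a) (f b) := by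
      obtain ⟨r1, r2, r3⟩ := rev_spec π hπ
      obtain ⟨h1, h2⟩ := he _ (List.mem_cons_self ..)
      simp only at h1 h2
      rcases h1 with rfl | rfl <;> rcases h2 with rfl | rfl
      · refine ⟨.comp (.inter .eps π) ρ, ?_, ?_, ?_⟩
        · simp only [IsICPDLProgram, PDLProgram.OK]; exact ⟨⟨trivial, trivial, hπ⟩, hρ⟩
        · simp; omega
        · intro W K f
          simp only [PDLProgram.rel]
          constructor
          · rintro ⟨w, ⟨rfl, h⟩, h'⟩; exact ⟨h', h⟩
          · rintro ⟨h', h⟩; exact ⟨_, ⟨rfl, h⟩, h'⟩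
      · refine ⟨.inter ρ π, ?_, ?_, ?_⟩
        · simp only [IsICPDLProgram, PDLProgram.OK]; exact ⟨trivial, hρ, hπ⟩
        · simp; omega
        · intro W K f; simp only [PDLProgram.rel]
      · refine ⟨.inter ρ π.rev, ?_, ?_, ?_⟩
        · simp only [IsICPDLProgram, PDLProgram.OK]; exact ⟨trivial, hρ, r1⟩
        · simp [r2]; omega
        · intro W K f; simp only [PDLProgram.rel, r3]
      · refine ⟨.comp ρ (.inter .eps π), ?_, ?_, ?_⟩
        · simp only [IsICPDLProgram, PDLProgram.OK]; exact ⟨hρ, ⟨trivial, trivial, hπ⟩⟩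
        · simp; omega
        · intro W K f
          simp only [PDLProgram.rel]
          constructor
          · rintro ⟨w, h', ⟨rfl, h⟩⟩; exact ⟨h', h⟩
          · rintro ⟨h', h⟩; exact ⟨_, h', ⟨rfl, h⟩⟩
    obtain ⟨σ, s1, s2, s3⟩ := key
    obtain ⟨ρ', t1, t2, t3⟩ := absorb x y L σ s1 (fun e h => hL e (List.mem_cons_of_mem _ h))
      (fun e h => he e (List.mem_cons_of_mem _ h))
    refine ⟨ρ', t1, ?_, ?_⟩
    · rw [mu_cons]; simp only; omega
    · intro W K f
      rw [t3, s3]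
      simp [LSat, and_assoc]

theorem collect (x y : ℕ) (L : List (PDLProgram × ℕ × ℕ)) (hL : LOK L)
    (he : ∀ e ∈ L, (e.2.1 = x ∨ e.2.1 = y) ∧ (e.2.2 = x ∨ e.2.2 = y))
    (hadj : LAdj L x y) :
    ∃ ρ, IsICPDLProgram ρ ∧ sizeOf ρ + 3 ≤ mu L ∧
      ∀ (W : Type) (K : Kripke W ℕ ℕ) (f : ℕ → W),
        ρ.rel K (f x) (f y) ↔ LSat K L f := by
  obtain ⟨e, hmem, hxy⟩ := hadj
  have hπ := hL e hmem
  obtain ⟨L1, L2, rfl⟩ := List.append_of_mem hmem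
  have seed : ∃ σ, IsICPDLProgram σ ∧ sizeOf σ = sizeOf e.1 ∧
      ∀ (W : Type) (K : Kripke W ℕ ℕ) (f : ℕ → W),
        σ.rel K (f x) (f y) ↔ e.1.rel K (f e.2.1) (f e.2.2) := by
    rcases hxy with ⟨rfl, rfl⟩ | ⟨rfl, rfl⟩
    · exact ⟨e.1, hπ, rfl, by simp⟩
    · obtain ⟨r1, r2, r3⟩ := rev_spec e.1 hπ
      exact ⟨e.1.rev, r1, r2, fun W K f => r3 ..⟩
  obtain ⟨σ, s1, s2, s3⟩ := seed
  obtain ⟨ρ, t1, t2, t3⟩ := absorb x y (L1 ++ L2) σ s1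
    (fun e' h => hL e' (by simp at h ⊢; tauto)) (fun e' h => he e' (by simp at h ⊢; tauto))
  refine ⟨ρ, t1, ?_, ?_⟩
  · rw [mu_append, mu_cons]; rw [mu_append] at t2; omega
  · intro W K f
    rw [t3, s3]
    constructor
    · rintro ⟨h1, h2⟩ e' h'
      simp at h'
      rcases h' with h' | rfl | h'
      · exact h2 e' (by simp [h'])
      · exact h1
      · exact h2 e' (by simp [h'])
    · intro h
      exact ⟨h e (by simp), fun e' h' => h e' (by simp at h' ⊢; tauto)⟩

theorem exists_leave {L : List (PDLProgram × ℕ × ℕ)} {x z : ℕ}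
    (h : Relation.ReflTransGen (LAdj L) x z) (hne : x ≠ z) : ∃ y, y ≠ x ∧ LAdj L x y := by
  induction h using Relation.ReflTransGen.head_induction_on with
  | refl => exact absurd rfl hne
  | head hab hbc ih =>
    rename_i a b
    by_cases hb : b = a
    · subst hb; exact ih hne
    · exact ⟨b, hb, hab⟩

theorem conn_elim {L L' : List (PDLProgram × ℕ × ℕ)} {v s : ℕ} (hs : s ≠ v)
    (h1 : ∀ x y, x ≠ v → y ≠ v → LAdj L x y → LAdj L' x y)
    (h2 : ∀ x y, x ≠ v → y ≠ v → LAdj L v x → LAdj L v y → Relation.ReflTransGen (LAdj L') x y)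
    {x : ℕ} (h : Relation.ReflTransGen (LAdj L) x s) :
    (x ≠ v → Relation.ReflTransGen (LAdj L') x s) ∧
    (x = v → ∀ y, y ≠ v → LAdj L v y → Relation.ReflTransGen (LAdj L') y s) := by
  induction h using Relation.ReflTransGen.head_induction_on with
  | refl => exact ⟨fun _ => .refl, fun h => absurd h hs⟩
  | head hab hbc ih =>
    rename_i a b
    constructor
    · intro ha
      by_cases hb : b = v
      · subst hb; exact ih.2 rfl a ha hab.symm
      · exact .head (h1 a b ha hb hab) (ih.1 hb)
    · rintro rfl y hy hvy
      by_cases hb : b = a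
      · exact ih.2 hb y hy hvy
      · exact (h2 y b hy hb hvy hab).trans (ih.1 hb)

theorem three_of_ncard {B : Set ℕ} (hf : B.Finite) (hc : B.ncard ≤ 3) {a b c z : ℕ}
    (ha : a ∈ B) (hb : b ∈ B) (hcc : c ∈ B) (hz : z ∈ B) (hab : a ≠ b) (hac : a ≠ c)
    (hbc : b ≠ c) : z = a ∨ z = b ∨ z = c := by
  by_contra hcon
  push Not at hcon
  obtain ⟨z1, z2, z3⟩ := hcon
  have hsub : (({a, b, c, z} : Finset ℕ) : Set ℕ) ⊆ B := by
    intro t ht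
    simp at ht
    rcases ht with rfl | rfl | rfl | rfl <;> assumption
  have := Set.ncard_le_ncard hsub hf
  rw [Set.ncard_coe_finset] at this
  have h4 : ({a, b, c, z} : Finset ℕ).card = 4 := by
    rw [Finset.card_insert_of_notMem, Finset.card_insert_of_notMem, Finset.card_insert_of_notMem] <;>
      simp <;> grind
  omega

theorem elim_step (R : ℕ → ℕ → Prop) (xs xt : ℕ) (S : Finset ℕ) (v : ℕ) (hv : v ∈ S)
    (hxs : xs ≠ v) (hxt : xt ≠ v)
    (B : Set ℕ) (hBf : B.Finite) (hBc : B.ncard ≤ 3) (hvB : v ∈ B)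
    (hBR : ∀ x ∈ B, ∀ y ∈ B, R x y)
    (hB : ∀ u, (u ∈ S ∨ u = xs ∨ u = xt) → R v u → u ∈ B)
    (L : List (PDLProgram × ℕ × ℕ)) (hOK : LOK L)
    (hend : ∀ x y, LAdj L x y → (x ∈ S ∨ x = xs ∨ x = xt) ∧ R x y)
    (hconn : ∀ x, (x ∈ S ∨ x = xs ∨ x = xt) → Relation.ReflTransGen (LAdj L) x xs) :
    ∃ L', LOK L' ∧ mu L' ≤ mu L + 2 ∧
      (∀ x y, LAdj L' x y → (x ∈ S.erase v ∨ x = xs ∨ x = xt) ∧ R x y) ∧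
      (∀ x, (x ∈ S.erase v ∨ x = xs ∨ x = xt) → Relation.ReflTransGen (LAdj L') x xs) ∧
      ∀ (W : Type) (K : Kripke W ℕ ℕ) (a b : W),
        (∃ f : ℕ → W, f xs = a ∧ f xt = b ∧ LSat K L f) ↔
        (∃ f : ℕ → W, f xs = a ∧ f xt = b ∧ LSat K L' f) := by
  classical
  -- reduce to replacing the `v`-atoms by one atom
  set p : PDLProgram × ℕ × ℕ → Prop := fun e => e.2.1 = v ∨ e.2.2 = v with hp
  set Lv := L.filter (fun e => decide (p e)) with hLv
  set Lr := L.filter (fun e => decide (¬ p e)) with hLr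
  have hmu : mu L = mu Lv + mu Lr := mu_filter p L
  have memv : ∀ e, e ∈ Lv ↔ e ∈ L ∧ (e.2.1 = v ∨ e.2.2 = v) := by
    intro e; simp [hLv, hp]
  have memr : ∀ e, e ∈ Lr ↔ e ∈ L ∧ e.2.1 ≠ v ∧ e.2.2 ≠ v := by
    intro e; simp [hLr, hp]
  have nbrB : ∀ y, LAdj L v y → y ∈ B := fun y hy =>
    hB y (hend _ _ hy.symm).1 (hend _ _ hy).2
  have suff : ∀ (σ : PDLProgram) (u w : ℕ), u ≠ v → w ≠ v → LAdj L v u → LAdj L v w →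
      IsICPDLProgram σ → sizeOf σ + 1 ≤ mu Lv →
      (∀ y, y ≠ v → LAdj L v y → y = u ∨ y = w) →
      (∀ (W : Type) (K : Kripke W ℕ ℕ) (f : ℕ → W), σ.rel K (f u) (f w) ↔
        ∃ d, LSat K Lv (Function.update f v d)) →
      ∃ L', LOK L' ∧ mu L' ≤ mu L + 2 ∧
      (∀ x y, LAdj L' x y → (x ∈ S.erase v ∨ x = xs ∨ x = xt) ∧ R x y) ∧
      (∀ x, (x ∈ S.erase v ∨ x = xs ∨ x = xt) → Relation.ReflTransGen (LAdj L') x xs) ∧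
      ∀ (W : Type) (K : Kripke W ℕ ℕ) (a b : W),
        (∃ f : ℕ → W, f xs = a ∧ f xt = b ∧ LSat K L f) ↔
        (∃ f : ℕ → W, f xs = a ∧ f xt = b ∧ LSat K L' f) := by
    intro σ u w huv hwv hu hw hσ hsz hnb hsem
    have adjuw : LAdj ((σ, u, w) :: Lr) u w := ⟨(σ, u, w), by simp, by simp⟩
    refine ⟨(σ, u, w) :: Lr, ?_, ?_, ?_, ?_, ?_⟩
    · intro e he
      rcases List.mem_cons.1 he with rfl | he
      · exact hσ
      · exact hOK e ((memr e).1 he).1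
    · rw [mu_cons]; simp only; omega
    · rintro x y ⟨e, he, hxy⟩
      rcases List.mem_cons.1 he with rfl | he
      · have := (hend _ _ hu.symm).1
        have := (hend _ _ hw.symm).1
        have := hBR u (nbrB u hu) w (nbrB w hw)
        have := hBR w (nbrB w hw) u (nbrB u hu)
        simp only at hxy
        rcases hxy with ⟨rfl, rfl⟩ | ⟨rfl, rfl⟩ <;> simp only [Finset.mem_erase] <;> tauto
      · have he' := (memr e).1 he
        have := hend x y ⟨e, he'.1, hxy⟩
        refine ⟨?_, this.2⟩
        have hxv : x ≠ v := by
          rcases hxy with ⟨rfl, rfl⟩ | ⟨rfl, rfl⟩ <;> tauto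
        simp only [Finset.mem_erase]; tauto
    · intro x hx
      have hxv : x ≠ v := by
        rcases hx with h | rfl | rfl
        · exact Finset.ne_of_mem_erase h
        · exact hxs
        · exact hxt
      refine (conn_elim hxs ?_ ?_ (hconn x ?_)).1 hxv
      · rintro x y hx hy ⟨e, he, hxy⟩
        refine ⟨e, List.mem_cons_of_mem _ ((memr e).2 ⟨he, ?_⟩), hxy⟩
        rcases hxy with ⟨rfl, rfl⟩ | ⟨rfl, rfl⟩ <;> tauto
      · intro x y hx hy h1 h2
        rcases hnb x hx h1 with rfl | rfl <;> rcases hnb y hy h2 with rfl | rfl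
        · exact .refl
        · exact .single adjuw
        · exact .single adjuw.symm
        · exact .refl
      · simp only [Finset.mem_erase] at hx; tauto
    · intro W K a b
      constructor
      · rintro ⟨f, h1, h2, h3⟩
        refine ⟨f, h1, h2, ?_⟩
        intro e he
        rcases List.mem_cons.1 he with rfl | he
        · refine (hsem W K f).2 ⟨f v, ?_⟩
          rw [Function.update_eq_self]
          exact fun e he => h3 e ((memv e).1 he).1
        · exact h3 e ((memr e).1 he).1
      · rintro ⟨f, h1, h2, h3⟩
        obtain ⟨d, hd⟩ := (hsem W K f).1 (h3 (σ, u, w) (by simp))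
        refine ⟨Function.update f v d, by simp [hxs, h1], by simp [hxt, h2], ?_⟩
        intro e he
        by_cases hev : e.2.1 = v ∨ e.2.2 = v
        · exact hd e ((memv e).2 ⟨he, hev⟩)
        · push Not at hev
          have := h3 e (List.mem_cons_of_mem _ ((memr e).2 ⟨he, hev⟩))
          rwa [Function.update_of_ne hev.1, Function.update_of_ne hev.2]
  obtain ⟨u, huv, hu⟩ := exists_leave (hconn v (Or.inl hv)) (Ne.symm hxs)
  have hadjv : ∀ e ∈ Lv, (e.2.1 = v ∨ LAdj L v e.2.1) ∧ (e.2.2 = v ∨ LAdj L v e.2.2) := by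
    intro e he
    obtain ⟨he, h⟩ := (memv e).1 he
    rcases h with h | h
    · exact ⟨Or.inl h, Or.inr ⟨e, he, Or.inl ⟨h.symm, rfl⟩⟩⟩
    · exact ⟨Or.inr ⟨e, he, Or.inr ⟨h.symm, rfl⟩⟩, Or.inl h⟩
  have adjLv : ∀ y, LAdj L v y → LAdj Lv v y := by
    rintro y ⟨e, he, h⟩
    refine ⟨e, (memv e).2 ⟨he, ?_⟩, h⟩
    rcases h with h | h
    · exact Or.inl h.1.symm
    · exact Or.inr h.1.symm
  have okLv : LOK Lv := fun e he => hOK e ((memv e).1 he).1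
  by_cases hw : ∃ w, w ≠ v ∧ w ≠ u ∧ LAdj L v w
  · obtain ⟨w, hwv, hwu, hw⟩ := hw
    have hnb : ∀ y, y ≠ v → LAdj L v y → y = u ∨ y = w := by
      intro y hy hvy
      rcases three_of_ncard hBf hBc hvB (nbrB u hu) (nbrB w hw) (nbrB y hvy) huv.symm hwv.symm
        hwu.symm with h | h | h
      · exact absurd h hy
      · exact Or.inl h
      · exact Or.inr h
    set q : PDLProgram × ℕ × ℕ → Prop := fun e => e.2.1 = u ∨ e.2.2 = u with hq
    have hmu2 := mu_filter q Lv
    set L1 := Lv.filter (fun e => decide (q e)) with hL1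
    set L2 := Lv.filter (fun e => decide (¬ q e)) with hL2
    have mem1 : ∀ e, e ∈ L1 ↔ e ∈ Lv ∧ (e.2.1 = u ∨ e.2.2 = u) := by
      intro e; simp [hL1, hq]
    have mem2 : ∀ e, e ∈ L2 ↔ e ∈ Lv ∧ e.2.1 ≠ u ∧ e.2.2 ≠ u := by
      intro e; simp [hL2, hq]
    obtain ⟨ρ1, a1, a2, a3⟩ := collect u v L1 (fun e he => okLv e ((mem1 e).1 he).1)
      (by
        intro e he
        obtain ⟨he1, he2⟩ := (mem1 e).1 he
        have h1 := ((memv e).1 he1).2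
        grind)
      (by
        obtain ⟨e, he, h⟩ := (adjLv u hu).symm
        refine ⟨e, (mem1 e).2 ⟨he, ?_⟩, h⟩
        grind)
    obtain ⟨ρ2, b1, b2, b3⟩ := collect v w L2 (fun e he => okLv e ((mem2 e).1 he).1)
      (by
        intro e he
        obtain ⟨he1, he2⟩ := (mem2 e).1 he
        have h1 := hadjv e he1
        have h2 := hnb e.2.1
        have h3 := hnb e.2.2
        grind)
      (by
        obtain ⟨e, he, h⟩ := (adjLv w hw)
        refine ⟨e, (mem2 e).2 ⟨he, ?_⟩, h⟩
        grind)
    refine suff (.comp ρ1 ρ2) u w huv hwv hu hw ?_ ?_ hnb ?_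
    · simp only [IsICPDLProgram, PDLProgram.OK]; exact ⟨a1, b1⟩
    · simp; omega
    · intro W K f
      simp only [PDLProgram.rel]
      refine exists_congr fun d => ?_
      have e1 := a3 W K (Function.update f v d)
      have e2 := b3 W K (Function.update f v d)
      simp only [Function.update_self, Function.update_of_ne huv, Function.update_of_ne hwv] at e1 e2
      rw [e1, e2]
      constructor
      · rintro ⟨h1, h2⟩ e he
        by_cases hqe : e.2.1 = u ∨ e.2.2 = u
        · exact h1 e ((mem1 e).2 ⟨he, hqe⟩)
        · push Not at hqe; exact h2 e ((mem2 e).2 ⟨he, hqe⟩)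
      · intro h
        exact ⟨fun e he => h e ((mem1 e).1 he).1, fun e he => h e ((mem2 e).1 he).1⟩
  · push Not at hw
    have hnb : ∀ y, y ≠ v → LAdj L v y → y = u := by
      intro y hy hvy
      by_contra hne
      exact hw y hy hne hvy
    obtain ⟨ρ, a1, a2, a3⟩ := collect u v Lv okLv
      (by
        intro e he
        have h1 := hadjv e he
        have h2 := hnb e.2.1
        have h3 := hnb e.2.2
        grind)
      (adjLv u hu).symm
    refine suff (.test (.diam ρ)) u u huv huv hu hu ?_ ?_ (fun y h1 h2 => Or.inl (hnb y h1 h2)) ?_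
    · simp only [IsICPDLProgram, PDLProgram.OK, PDLFormula.OK]; exact a1
    · simp; omega
    · intro W K f
      simp only [PDLProgram.rel, PDLFormula.sat, true_and]
      refine exists_congr fun d => ?_
      have e1 := a3 W K (Function.update f v d)
      simp only [Function.update_self, Function.update_of_ne huv] at e1
      exact e1

theorem elim_all (R : ℕ → ℕ → Prop) (xs xt : ℕ)
    (hR : ∀ S : Finset ℕ, S.Nonempty → (∀ x ∈ S, R x x) → ∃ v ∈ S, ∃ B : Set ℕ,
      B.Finite ∧ B.ncard ≤ 3 ∧ v ∈ B ∧ (∀ x ∈ B, ∀ y ∈ B, R x y) ∧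
      ∀ u, (u ∈ S ∨ u = xs ∨ u = xt) → R v u → u ∈ B) :
    ∀ (n : ℕ) (S : Finset ℕ), S.card = n → xs ∉ S → xt ∉ S → (∀ x ∈ S, R x x) →
    ∀ (L : List (PDLProgram × ℕ × ℕ)), LOK L →
    (∀ x y, LAdj L x y → (x ∈ S ∨ x = xs ∨ x = xt) ∧ R x y) →
    (∀ x, (x ∈ S ∨ x = xs ∨ x = xt) → Relation.ReflTransGen (LAdj L) x xs) →
    ∃ ρ, IsICPDLProgram ρ ∧ sizeOf ρ ≤ mu L + 2 * n + 3 ∧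
      ∀ (W : Type) (K : Kripke W ℕ ℕ) (a b : W), ρ.rel K a b ↔
        (∃ f : ℕ → W, f xs = a ∧ f xt = b ∧ LSat K L f) := by
  intro n
  induction n with
  | zero =>
    intro S hS _ _ _ L hOK hend hconn
    obtain rfl := Finset.card_eq_zero.1 hS
    have hends : ∀ e ∈ L, (e.2.1 = xs ∨ e.2.1 = xt) ∧ (e.2.2 = xs ∨ e.2.2 = xt) := by
      intro e he
      have h1 := (hend e.2.1 e.2.2 ⟨e, he, Or.inl ⟨rfl, rfl⟩⟩).1
      have h2 := (hend e.2.2 e.2.1 ⟨e, he, Or.inr ⟨rfl, rfl⟩⟩).1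
      simpa using And.intro h1 h2
    by_cases hst : xs = xt
    · subst hst
      obtain ⟨ρ, a1, a2, a3⟩ := absorb xs xs L .eps (by simp [IsICPDLProgram, PDLProgram.OK]) hOK hends
      refine ⟨.inter .eps ρ, ?_, ?_, ?_⟩
      · simp only [IsICPDLProgram, PDLProgram.OK]; exact ⟨trivial, trivial, a1⟩
      · simp at a2 ⊢; omega
      · intro W K a b
        simp only [PDLProgram.rel] at a3 ⊢
        constructor
        · rintro ⟨rfl, h⟩
          exact ⟨fun _ => a, rfl, rfl, ((a3 W K (fun _ => a)).1 h).2⟩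
        · rintro ⟨f, rfl, rfl, h⟩
          exact ⟨rfl, (a3 W K f).2 ⟨trivial, h⟩⟩
    · obtain ⟨y, hy, hadj⟩ := exists_leave (hconn xt (by simp)) (Ne.symm hst)
      have hy' : y = xs := by
        have := (hend y xt hadj.symm).1
        simp at this; tauto
      subst hy'
      obtain ⟨ρ, a1, a2, a3⟩ := collect y xt L hOK hends hadj.symm
      refine ⟨ρ, a1, by omega, ?_⟩
      intro W K a b
      constructor
      · intro h
        refine ⟨fun n => if n = y then a else b, by simp, by simp [Ne.symm hst], ?_⟩
        rw [← a3]
        simpa [Ne.symm hst] using h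
      · rintro ⟨f, rfl, rfl, h⟩
        exact (a3 W K f).2 h
  | succ n ih =>
    intro S hS hxs hxt hRS L hOK hend hconn
    obtain ⟨v, hv, B, hBf, hBc, hvB, hBR, hB⟩ := hR S (Finset.card_pos.1 (by omega)) hRS
    obtain ⟨L', c1, c2, c3, c4, c5⟩ := elim_step R xs xt S v hv (by rintro rfl; exact hxs hv)
      (by rintro rfl; exact hxt hv) B hBf hBc hvB hBR hB L hOK hend hconn
    obtain ⟨ρ, d1, d2, d3⟩ := ih (S.erase v) (by rw [Finset.card_erase_of_mem hv]; omega)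
      (fun h => hxs (Finset.mem_of_mem_erase h)) (fun h => hxt (Finset.mem_of_mem_erase h))
      (fun x hx => hRS x (Finset.mem_of_mem_erase hx)) L' c1 c3 c4
    refine ⟨ρ, d1, by omega, ?_⟩
    intro W K a b
    rw [d3, c5]

/-! ## Tree decompositions -/

theorem anc_step {ι : Type} {T : SimpleGraph ι} (hT : T.IsTree) {r b c c' : ι}
    (hadj : T.Adj c c') (h : ∀ p : T.Walk r c, b ∈ p.support) :
    (∀ p : T.Walk r c', b ∈ p.support) ∨ (c = b ∧ T.dist r c' < T.dist r b) := by
  classical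
  by_contra hcon
  push Not at hcon
  obtain ⟨⟨p0, hp0⟩, h2⟩ := hcon
  let p := p0.bypass
  have hp : b ∉ p.support := fun hb => hp0 (SimpleGraph.Walk.support_bypass_subset p0 hb)
  have hpp : p.IsPath := p0.bypass_isPath
  have hb := h (p.concat hadj.symm)
  rw [SimpleGraph.Walk.support_concat] at hb
  have hbc : b = c := by
    simp at hb
    tauto
  subst hbc
  have h3 := h2 rfl
  have hpath : (p.concat hadj.symm).IsPath := hpp.concat hp hadj.symm
  obtain ⟨q, hq, hql⟩ := hT.1.exists_path_of_dist r b
  have huniq := hT.2.path_unique ⟨q, hq⟩ ⟨_, hpath⟩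
  have : q = p.concat hadj.symm := congrArg Subtype.val huniq
  rw [this, SimpleGraph.Walk.length_concat] at hql
  have := SimpleGraph.dist_le p
  omega

theorem td_elim {G : UGraph ℕ} (td : TreeDecomp G) (hw : td.WidthLE 2) (xs xt : ℕ) (r : td.ι)
    (hs : xs ∈ td.bag r) (ht : xt ∈ td.bag r) (S : Finset ℕ) (hne : S.Nonempty)
    (hS : ∀ x ∈ S, ∃ b, x ∈ td.bag b ∧ x ∈ td.bag b) :
    ∃ v ∈ S, ∃ B : Set ℕ, B.Finite ∧ B.ncard ≤ 3 ∧ v ∈ B ∧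
      (∀ x ∈ B, ∀ y ∈ B, ∃ b, x ∈ td.bag b ∧ y ∈ td.bag b) ∧
      ∀ u, (u ∈ S ∨ u = xs ∨ u = xt) → (∃ b, v ∈ td.bag b ∧ u ∈ td.bag b) → u ∈ B := by
  classical
  have htop : ∀ x, (∃ b, x ∈ td.bag b) → ∃ b, x ∈ td.bag b ∧
      ∀ b', x ∈ td.bag b' → td.T.dist r b ≤ td.T.dist r b' := by
    rintro x ⟨b, hb⟩
    have hex : ∃ n, ∃ b, x ∈ td.bag b ∧ td.T.dist r b = n := ⟨_, b, hb, rfl⟩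
    obtain ⟨b0, h0, h1⟩ := Nat.find_spec hex
    refine ⟨b0, h0, fun b' hb' => ?_⟩
    rw [h1]
    exact Nat.find_min' hex ⟨b', hb', rfl⟩
  have : Nonempty td.ι := ⟨r⟩
  choose! top t1 t2 using htop
  obtain ⟨v, hv, hmax⟩ := S.exists_max_image (fun x => td.T.dist r (top x)) hne
  have hvb : ∃ b, v ∈ td.bag b := by obtain ⟨b, hb, _⟩ := hS v hv; exact ⟨b, hb⟩
  refine ⟨v, hv, td.bag (top v), (hw _).1, (hw _).2, t1 v hvb, fun x hx y hy => ⟨_, hx, hy⟩, ?_⟩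
  rintro u hu ⟨b', hvb', hub'⟩
  by_contra hub
  have hD : td.T.dist r (top u) ≤ td.T.dist r (top v) := by
    rcases hu with hu | rfl | rfl
    · exact hmax u hu
    · have := t2 u ⟨_, hub'⟩ r hs
      rw [SimpleGraph.dist_self] at this; omega
    · have := t2 u ⟨_, hub'⟩ r ht
      rw [SimpleGraph.dist_self] at this; omega
  have hA : ∀ p : td.T.Walk r b', top v ∈ p.support := by
    have hchain := td.conn v (top v) b' (t1 v hvb) hvb'
    have : ∀ z, Relation.ReflTransGen (fun c c' => td.T.Adj c c' ∧ v ∈ td.bag c ∧ v ∈ td.bag c')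
        (top v) z → (∀ p : td.T.Walk r z, top v ∈ p.support) := by
      intro z hz
      induction hz with
      | refl => intro p; simp
      | tail _ hstep ih =>
        rcases anc_step td.isTree hstep.1 ih with h | h
        · exact h
        · have := t2 v hvb _ hstep.2.2
          omega
    exact this _ hchain
  have hB : (∀ p : td.T.Walk r (top u), top v ∈ p.support) ∧ top u ≠ top v := by
    have hchain := td.conn u b' (top u) hub' (t1 u ⟨_, hub'⟩)
    have : ∀ z, Relation.ReflTransGen (fun c c' => td.T.Adj c c' ∧ u ∈ td.bag c ∧ u ∈ td.bag c') b' z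
        → (∀ p : td.T.Walk r z, top v ∈ p.support) ∧ z ≠ top v := by
      intro z hz
      induction hz with
      | refl => exact ⟨hA, by rintro rfl; exact hub hub'⟩
      | tail _ hstep ih =>
        refine ⟨?_, by rintro rfl; exact hub hstep.2.2⟩
        rcases anc_step td.isTree hstep.1 ih.1 with h | h
        · exact h
        · exact absurd h.1 ih.2
    exact this _ hchain
  obtain ⟨p, hp, hpl⟩ := td.isTree.1.exists_path_of_dist r (top u)
  have hmem := hB.1 p
  have h1 := SimpleGraph.Walk.length_takeUntil_lt hmem hB.2.symm
  have h2 := SimpleGraph.dist_le (p.takeUntil _ hmem)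
  omega

theorem tw_of_iso {G H : UGraph ℕ} {k : ℕ} (hG : ∀ x y, G.adj x y → x ∈ G.verts ∧ y ∈ G.verts)
    (h : G.Iso H) (hH : H.TreewidthLE k) : G.TreewidthLE k := by
  obtain ⟨g, hg, hadj⟩ := h
  obtain ⟨td, hw⟩ := hH
  refine ⟨⟨td.ι, td.T, td.isTree, fun b => {x | x ∈ G.verts ∧ g x ∈ td.bag b}, ?_, ?_, ?_⟩, ?_⟩
  · intro v hv
    obtain ⟨b, hb⟩ := td.cov_vert (g v) (hg.1 hv)
    exact ⟨b, hv, hb⟩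
  · intro x y hxy
    obtain ⟨hx, hy⟩ := hG x y hxy
    obtain ⟨b, h1, h2⟩ := td.cov_edge _ _ ((hadj x hx y hy).1 hxy)
    exact ⟨b, ⟨hx, h1⟩, ⟨hy, h2⟩⟩
  · rintro v b b' ⟨hv, h1⟩ ⟨_, h2⟩
    exact Relation.ReflTransGen.mono (fun c c' h => ⟨h.1, ⟨hv, h.2.1⟩, ⟨hv, h.2.2⟩⟩) _ _ (td.conn (g v) b b' h1 h2)
  · intro b
    have hinj : Set.InjOn g {x | x ∈ G.verts ∧ g x ∈ td.bag b} :=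
      hg.2.1.mono fun x hx => hx.1
    have hsub : g '' {x | x ∈ G.verts ∧ g x ∈ td.bag b} ⊆ td.bag b := by
      rintro _ ⟨x, hx, rfl⟩; exact hx.2
    refine ⟨Set.Finite.of_finite_image ((hw b).1.subset hsub) hinj, ?_⟩
    rw [← Set.ncard_image_of_injOn hinj]
    exact (Set.ncard_le_ncard hsub (hw b).1).trans (hw b).2

theorem lsat_toList {W : Type} (K : Kripke W ℕ ℕ) (f : ℕ → W) : ∀ C : AtomList,
    C.sat K f ↔ LSat K C.toList f
  | .nil => by simp [AtomList.sat, LSat, AtomList.toList]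
  | .acons π x y C => by
    have := lsat_toList K f C
    simp only [LSat] at this
    simp [AtomList.sat, LSat, AtomList.toList, this]

theorem cprog_case (C : AtomList) (xs xt : ℕ) (hs : xs ∈ C.vars) (ht : xt ∈ C.vars)
    (hconn : C.graphC.Connected) (hG : ∃ H ∈ TWClass 2, (cprogGraph C xs xt).Iso H)
    (L : List (PDLProgram × ℕ × ℕ)) (hL : LOK L) (hmap : L.map Prod.snd = C.toList.map Prod.snd)
    (hsem : ∀ (W : Type) (K : Kripke W ℕ ℕ) (f : ℕ → W), C.sat K f ↔ LSat K L f) :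
    ∃ ρ, IsICPDLProgram ρ ∧ ProgEquiv (.cprog C xs xt) ρ ∧
      sizeOf ρ ≤ mu L + 4 * L.length + 3 := by
  classical
  have hadjL : ∀ x y, C.graphC.adj x y ↔ LAdj L x y := by
    intro x y
    have e1 : C.graphC.adj x y ↔ ∃ q ∈ C.toList.map Prod.snd, (x = q.1 ∧ y = q.2) ∨ (x = q.2 ∧ y = q.1) := by
      simp only [AtomList.graphC, List.mem_map]
      constructor
      · rintro ⟨e, he, h⟩; exact ⟨e.2, ⟨e, he, rfl⟩, h⟩
      · rintro ⟨_, ⟨e, he, rfl⟩, h⟩; exact ⟨e, he, h⟩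
    rw [e1, ← hmap]
    simp only [LAdj, List.mem_map]
    constructor
    · rintro ⟨_, ⟨e, he, rfl⟩, h⟩; exact ⟨e, he, h⟩
    · rintro ⟨e, he, h⟩; exact ⟨e.2, ⟨e, he, rfl⟩, h⟩
  have hvar : ∀ x y, C.graphC.adj x y → x ∈ C.vars ∧ y ∈ C.vars := by
    rintro x y ⟨e, he, h⟩
    rcases h with ⟨rfl, rfl⟩ | ⟨rfl, rfl⟩
    · exact ⟨⟨e, he, Or.inl rfl⟩, ⟨e, he, Or.inr rfl⟩⟩
    · exact ⟨⟨e, he, Or.inr rfl⟩, ⟨e, he, Or.inl rfl⟩⟩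
  obtain ⟨H, ⟨_, hH⟩, hiso⟩ := hG
  obtain ⟨td, hw⟩ := tw_of_iso (G := cprogGraph C xs xt) (by
    intro x y h
    rcases h with h | ⟨rfl, rfl⟩ | ⟨rfl, rfl⟩
    · exact hvar x y h
    · exact ⟨hs, ht⟩
    · exact ⟨ht, hs⟩) hiso hH
  obtain ⟨r, hr1, hr2⟩ := td.cov_edge xs xt (Or.inr (Or.inl ⟨rfl, rfl⟩))
  let V : List ℕ := C.toList.map (fun e => e.2.1) ++ C.toList.map (fun e => e.2.2)
  have hV : ∀ x, x ∈ V ↔ x ∈ C.vars := by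
    intro x
    simp only [V, AtomList.vars, List.mem_append, List.mem_map, Set.mem_setOf_eq]
    constructor
    · rintro (⟨e, he, rfl⟩ | ⟨e, he, rfl⟩)
      · exact ⟨e, he, Or.inl rfl⟩
      · exact ⟨e, he, Or.inr rfl⟩
    · rintro ⟨e, he, rfl | rfl⟩
      · exact Or.inl ⟨e, he, rfl⟩
      · exact Or.inr ⟨e, he, rfl⟩
  let S : Finset ℕ := (V.toFinset.erase xs).erase xt
  have hS : ∀ x, (x ∈ S ∨ x = xs ∨ x = xt) ↔ x ∈ C.vars := by
    intro x
    simp only [S, Finset.mem_erase, List.mem_toFinset, hV]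
    by_cases h1 : x = xs
    · subst h1; simp [hs]
    · by_cases h2 : x = xt
      · subst h2; simp [ht]
      · simp [h1, h2]
  have hlen : L.length = C.toList.length := by
    have := congrArg List.length hmap
    simpa using this
  have hcard : S.card ≤ 2 * L.length := by
    have h1 : S.card ≤ V.toFinset.card :=
      Finset.card_le_card ((Finset.erase_subset _ _).trans (Finset.erase_subset _ _))
    have h2 := V.toFinset_card_le
    have h3 : V.length = 2 * L.length := by simp [V, hlen]; omega
    omega
  obtain ⟨ρ, d1, d2, d3⟩ := elim_all (fun x y => ∃ b, x ∈ td.bag b ∧ y ∈ td.bag b) xs xt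
    (fun S hne hS => td_elim td hw xs xt r hr1 hr2 S hne hS) S.card S rfl
    (by simp [S]) (by simp [S])
    (by
      intro x hx
      obtain ⟨b, hb⟩ := td.cov_vert x ((hS x).1 (Or.inl hx))
      exact ⟨b, hb, hb⟩)
    L hL
    (by
      intro x y hxy
      have hxy' := (hadjL x y).2 hxy
      exact ⟨(hS x).2 (hvar x y hxy').1, td.cov_edge x y (Or.inl hxy')⟩)
    (by
      intro x hx
      exact Relation.ReflTransGen.mono (fun a b h => (hadjL a b).1 h) _ _ (hconn.2 x ((hS x).1 hx) xs hs))
  refine ⟨ρ, d1, ?_, by omega⟩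
  intro W K a b
  rw [d3]
  simp only [PDLProgram.rel, hsem]

/-! ## Translations -/

mutual
theorem toI_F : ∀ φ : PDLFormula, CPDLTWFormula 2 φ →
    ∃ ψ, IsICPDLFormula ψ ∧ FormEquiv φ ψ ∧ sizeOf ψ ≤ 8 * sizeOf φ
  | .prop p, _ => ⟨.prop p, by simp [IsICPDLFormula, PDLFormula.OK], fun _ _ _ => Iff.rfl,
      by omega⟩
  | .neg φ, h => by
    simp only [CPDLTWFormula, PDLFormula.OK] at h
    obtain ⟨ψ, a1, a2, a3⟩ := toI_F φ h.2
    refine ⟨.neg ψ, ?_, ?_, ?_⟩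
    · simp only [IsICPDLFormula, PDLFormula.OK]; exact ⟨trivial, a1⟩
    · intro W K w; simp only [PDLFormula.sat, a2 W K w]
    · simp; omega
  | .conj φ φ', h => by
    simp only [CPDLTWFormula, PDLFormula.OK] at h
    obtain ⟨ψ, a1, a2, a3⟩ := toI_F φ h.1
    obtain ⟨ψ', b1, b2, b3⟩ := toI_F φ' h.2
    refine ⟨.conj ψ ψ', ?_, ?_, ?_⟩
    · simp only [IsICPDLFormula, PDLFormula.OK]; exact ⟨a1, b1⟩
    · intro W K w; simp only [PDLFormula.sat, a2 W K w, b2 W K w]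
    · simp; omega
  | .diam π, h => by
    simp only [CPDLTWFormula, PDLFormula.OK] at h
    obtain ⟨ρ, a1, a2, a3⟩ := toI_P π h
    refine ⟨.diam ρ, ?_, ?_, ?_⟩
    · simp only [IsICPDLFormula, PDLFormula.OK]; exact a1
    · intro W K w; simp only [PDLFormula.sat, a2 W K]
    · simp; omega
  | .floop π, h => by
    simp [CPDLTWFormula, PDLFormula.OK] at h
theorem toI_P : ∀ π : PDLProgram, CPDLTWProgram 2 π →
    ∃ ρ, IsICPDLProgram ρ ∧ ProgEquiv π ρ ∧ sizeOf ρ ≤ 8 * sizeOf π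
  | .eps, _ => ⟨.eps, by simp [IsICPDLProgram, PDLProgram.OK], fun _ _ _ _ => Iff.rfl, by omega⟩
  | .atom a, _ =>
    ⟨.atom a, by simp [IsICPDLProgram, PDLProgram.OK], fun _ _ _ _ => Iff.rfl, by omega⟩
  | .conv a, _ =>
    ⟨.conv a, by simp [IsICPDLProgram, PDLProgram.OK], fun _ _ _ _ => Iff.rfl, by omega⟩
  | .punion π π', h => by
    simp only [CPDLTWProgram, PDLProgram.OK] at h
    obtain ⟨ψ, a1, a2, a3⟩ := toI_P π h.1
    obtain ⟨ψ', b1, b2, b3⟩ := toI_P π' h.2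
    refine ⟨.punion ψ ψ', ?_, ?_, ?_⟩
    · simp only [IsICPDLProgram, PDLProgram.OK]; exact ⟨a1, b1⟩
    · intro W K u v; simp only [PDLProgram.rel, a2 W K, b2 W K]
    · simp; omega
  | .comp π π', h => by
    simp only [CPDLTWProgram, PDLProgram.OK] at h
    obtain ⟨ψ, a1, a2, a3⟩ := toI_P π h.1
    obtain ⟨ψ', b1, b2, b3⟩ := toI_P π' h.2
    refine ⟨.comp ψ ψ', ?_, ?_, ?_⟩
    · simp only [IsICPDLProgram, PDLProgram.OK]; exact ⟨a1, b1⟩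
    · intro W K u v; simp only [PDLProgram.rel, a2 W K, b2 W K]
    · simp; omega
  | .star π, h => by
    simp only [CPDLTWProgram, PDLProgram.OK] at h
    obtain ⟨ψ, a1, a2, a3⟩ := toI_P π h
    refine ⟨.star ψ, ?_, ?_, ?_⟩
    · simp only [IsICPDLProgram, PDLProgram.OK]; exact a1
    · intro W K u v; simp only [PDLProgram.rel, a2 W K]
    · simp; omega
  | .test φ, h => by
    simp only [CPDLTWProgram, PDLProgram.OK] at h
    obtain ⟨ψ, a1, a2, a3⟩ := toI_F φ h
    refine ⟨.test ψ, ?_, ?_, ?_⟩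
    · simp only [IsICPDLProgram, PDLProgram.OK]; exact a1
    · intro W K u v; simp only [PDLProgram.rel, a2 W K]
    · simp; omega
  | .inter _ _, h => by
    simp [CPDLTWProgram, PDLProgram.OK] at h
  | .cprog C xs xt, h => by
    simp only [CPDLTWProgram, PDLProgram.OK] at h
    obtain ⟨h1, h2, h3, h4, h5⟩ := h
    obtain ⟨L, a1, a2, a3, a4⟩ := toI_L C h5
    obtain ⟨ρ, b1, b2, b3⟩ := cprog_case C xs xt h1 h2 h3 h4 L a1 a2 a3
    refine ⟨ρ, b1, b2, ?_⟩
    simp; omega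
theorem toI_L : ∀ C : AtomList, AtomList.OK false false true (TWClass 2) C →
    ∃ L : List (PDLProgram × ℕ × ℕ), LOK L ∧ L.map Prod.snd = C.toList.map Prod.snd ∧
      (∀ (W : Type) (K : Kripke W ℕ ℕ) (f : ℕ → W), C.sat K f ↔ LSat K L f) ∧
      mu L + 4 * L.length ≤ 8 * sizeOf C
  | .nil, _ => ⟨[], by simp [LOK], by simp [AtomList.toList],
      by simp [AtomList.sat, LSat], by simp [mu]⟩
  | .acons π x y C, h => by
    simp only [AtomList.OK] at h
    obtain ⟨ρ, b1, b2, b3⟩ := toI_P π h.1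
    obtain ⟨L, a1, a2, a3, a4⟩ := toI_L C h.2
    refine ⟨(ρ, x, y) :: L, ?_, ?_, ?_, ?_⟩
    · intro e he
      rcases List.mem_cons.1 he with rfl | he
      · exact b1
      · exact a1 e he
    · simp [AtomList.toList, a2]
    · intro W K f
      simp only [AtomList.sat, b2 W K, a3]
      simp [LSat]
    · rw [mu_cons]; simp; omega
end

theorem cap_tw1 (π ρ : PDLProgram) :
    ∃ H ∈ TWClass 1, (cprogGraph (.acons π 0 1 (.acons ρ 0 1 .nil)) 0 1).Iso H := by
  refine ⟨capGraph, ⟨by simp [capGraph], ?_⟩, id, ?_, ?_⟩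
  · refine ⟨⟨Unit, ⊥, ?_, fun _ => {0, 1}, ?_, ?_, ?_⟩, ?_⟩
    · exact SimpleGraph.IsTree.of_subsingleton
    · intro v hv; exact ⟨(), hv⟩
    · rintro x y (⟨rfl, rfl⟩ | ⟨rfl, rfl⟩) <;> exact ⟨(), by simp, by simp⟩
    · rintro v ⟨⟩ ⟨⟩ _ _; exact .refl
    · intro b
      refine ⟨by simp, ?_⟩
      exact Set.ncard_pair (by simp) |>.le
  · have : (cprogGraph (.acons π 0 1 (.acons ρ 0 1 .nil)) 0 1).verts = capGraph.verts := by
      ext z; simp [cprogGraph, capGraph, AtomList.vars, AtomList.toList]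
    rw [this]
    exact Set.bijOn_id _
  · intro x _ y _
    simp [cprogGraph, capGraph, AtomList.graphC, AtomList.toList]

theorem cap_ok (π ρ : PDLProgram) (h1 : CPDLTWProgram 1 π) (h2 : CPDLTWProgram 1 ρ) :
    CPDLTWProgram 1 (.cprog (.acons π 0 1 (.acons ρ 0 1 .nil)) 0 1) := by
  simp only [CPDLTWProgram, PDLProgram.OK, AtomList.OK]
  refine ⟨?_, ?_, ?_, cap_tw1 π ρ, h1, h2, trivial⟩
  · simp [AtomList.vars, AtomList.toList]
  · simp [AtomList.vars, AtomList.toList]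
  · refine ⟨⟨0, by simp [AtomList.graphC, AtomList.vars, AtomList.toList]⟩, ?_⟩
    intro x hx y hy
    simp [AtomList.graphC, AtomList.vars, AtomList.toList] at hx hy
    rcases hx with rfl | rfl <;> rcases hy with rfl | rfl
    · exact .refl
    · exact .single (by simp [AtomList.graphC, AtomList.toList])
    · exact .single (by simp [AtomList.graphC, AtomList.toList])
    · exact .refl

mutual
theorem fromI_F : ∀ φ : PDLFormula, IsICPDLFormula φ →
    ∃ ψ, CPDLTWFormula 1 ψ ∧ FormEquiv φ ψ ∧ sizeOf ψ ≤ 8 * sizeOf φ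
  | .prop p, _ => ⟨.prop p, by simp [CPDLTWFormula, PDLFormula.OK], fun _ _ _ => Iff.rfl,
      by omega⟩
  | .neg φ, h => by
    simp only [IsICPDLFormula, PDLFormula.OK] at h
    obtain ⟨ψ, a1, a2, a3⟩ := fromI_F φ h.2
    refine ⟨.neg ψ, ?_, ?_, ?_⟩
    · simp only [CPDLTWFormula, PDLFormula.OK]; exact ⟨trivial, a1⟩
    · intro W K w; simp only [PDLFormula.sat, a2 W K w]
    · simp; omega
  | .conj φ φ', h => by
    simp only [IsICPDLFormula, PDLFormula.OK] at h
    obtain ⟨ψ, a1, a2, a3⟩ := fromI_F φ h.1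
    obtain ⟨ψ', b1, b2, b3⟩ := fromI_F φ' h.2
    refine ⟨.conj ψ ψ', ?_, ?_, ?_⟩
    · simp only [CPDLTWFormula, PDLFormula.OK]; exact ⟨a1, b1⟩
    · intro W K w; simp only [PDLFormula.sat, a2 W K w, b2 W K w]
    · simp; omega
  | .diam π, h => by
    simp only [IsICPDLFormula, PDLFormula.OK] at h
    obtain ⟨ρ, a1, a2, a3⟩ := fromI_P π h
    refine ⟨.diam ρ, ?_, ?_, ?_⟩
    · simp only [CPDLTWFormula, PDLFormula.OK]; exact a1
    · intro W K w; simp only [PDLFormula.sat, a2 W K]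
    · simp; omega
  | .floop π, h => by
    simp [IsICPDLFormula, PDLFormula.OK] at h
theorem fromI_P : ∀ π : PDLProgram, IsICPDLProgram π →
    ∃ ρ, CPDLTWProgram 1 ρ ∧ ProgEquiv π ρ ∧ sizeOf ρ ≤ 8 * sizeOf π
  | .eps, _ => ⟨.eps, by simp [CPDLTWProgram, PDLProgram.OK], fun _ _ _ _ => Iff.rfl, by omega⟩
  | .atom a, _ =>
    ⟨.atom a, by simp [CPDLTWProgram, PDLProgram.OK], fun _ _ _ _ => Iff.rfl, by omega⟩
  | .conv a, _ =>
    ⟨.conv a, by simp [CPDLTWProgram, PDLProgram.OK], fun _ _ _ _ => Iff.rfl, by omega⟩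
  | .punion π π', h => by
    simp only [IsICPDLProgram, PDLProgram.OK] at h
    obtain ⟨ψ, a1, a2, a3⟩ := fromI_P π h.1
    obtain ⟨ψ', b1, b2, b3⟩ := fromI_P π' h.2
    refine ⟨.punion ψ ψ', ?_, ?_, ?_⟩
    · simp only [CPDLTWProgram, PDLProgram.OK]; exact ⟨a1, b1⟩
    · intro W K u v; simp only [PDLProgram.rel, a2 W K, b2 W K]
    · simp; omega
  | .comp π π', h => by
    simp only [IsICPDLProgram, PDLProgram.OK] at h
    obtain ⟨ψ, a1, a2, a3⟩ := fromI_P π h.1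
    obtain ⟨ψ', b1, b2, b3⟩ := fromI_P π' h.2
    refine ⟨.comp ψ ψ', ?_, ?_, ?_⟩
    · simp only [CPDLTWProgram, PDLProgram.OK]; exact ⟨a1, b1⟩
    · intro W K u v; simp only [PDLProgram.rel, a2 W K, b2 W K]
    · simp; omega
  | .star π, h => by
    simp only [IsICPDLProgram, PDLProgram.OK] at h
    obtain ⟨ψ, a1, a2, a3⟩ := fromI_P π h
    refine ⟨.star ψ, ?_, ?_, ?_⟩
    · simp only [CPDLTWProgram, PDLProgram.OK]; exact a1
    · intro W K u v; simp only [PDLProgram.rel, a2 W K]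
    · simp; omega
  | .test φ, h => by
    simp only [IsICPDLProgram, PDLProgram.OK] at h
    obtain ⟨ψ, a1, a2, a3⟩ := fromI_F φ h
    refine ⟨.test ψ, ?_, ?_, ?_⟩
    · simp only [CPDLTWProgram, PDLProgram.OK]; exact a1
    · intro W K u v; simp only [PDLProgram.rel, a2 W K]
    · simp; omega
  | .inter π π', h => by
    simp only [IsICPDLProgram, PDLProgram.OK] at h
    obtain ⟨ψ, a1, a2, a3⟩ := fromI_P π h.2.1
    obtain ⟨ψ', b1, b2, b3⟩ := fromI_P π' h.2.2
    refine ⟨.cprog (.acons ψ 0 1 (.acons ψ' 0 1 .nil)) 0 1, cap_ok ψ ψ' a1 b1, ?_, ?_⟩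
    · intro W K u v
      simp only [PDLProgram.rel, AtomList.sat, a2 W K, b2 W K, and_true]
      constructor
      · intro h
        exact ⟨fun n => if n = 0 then u else v, by simp, by simp, by simpa using h⟩
      · rintro ⟨f, rfl, rfl, h⟩; exact h
    · simp; omega
  | .cprog C xs xt, h => by
    simp [IsICPDLProgram, PDLProgram.OK] at h
end

theorem tw_mono : TWClass 1 ⊆ TWClass 2 := by
  rintro G ⟨h, td, hw⟩
  exact ⟨h, td, fun b => ⟨(hw b).1, (hw b).2.trans (by omega)⟩⟩

mutual
theorem mono_F : ∀ φ : PDLFormula, CPDLTWFormula 1 φ → CPDLTWFormula 2 φ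
  | .prop p, _ => by simp [CPDLTWFormula, PDLFormula.OK]
  | .neg φ, h => by
    simp only [CPDLTWFormula, PDLFormula.OK] at h ⊢
    exact ⟨trivial, mono_F φ h.2⟩
  | .conj φ φ', h => by
    simp only [CPDLTWFormula, PDLFormula.OK] at h ⊢
    exact ⟨mono_F φ h.1, mono_F φ' h.2⟩
  | .diam π, h => by
    simp only [CPDLTWFormula, PDLFormula.OK] at h ⊢
    exact mono_P π h
  | .floop π, h => by
    simp [CPDLTWFormula, PDLFormula.OK] at h
theorem mono_P : ∀ π : PDLProgram, CPDLTWProgram 1 π → CPDLTWProgram 2 π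
  | .eps, _ => by simp [CPDLTWProgram, PDLProgram.OK]
  | .atom a, _ => by simp [CPDLTWProgram, PDLProgram.OK]
  | .conv a, _ => by simp [CPDLTWProgram, PDLProgram.OK]
  | .punion π π', h => by
    simp only [CPDLTWProgram, PDLProgram.OK] at h ⊢
    exact ⟨mono_P π h.1, mono_P π' h.2⟩
  | .comp π π', h => by
    simp only [CPDLTWProgram, PDLProgram.OK] at h ⊢
    exact ⟨mono_P π h.1, mono_P π' h.2⟩
  | .star π, h => by
    simp only [CPDLTWProgram, PDLProgram.OK] at h ⊢
    exact mono_P π h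
  | .test φ, h => by
    simp only [CPDLTWProgram, PDLProgram.OK] at h ⊢
    exact mono_F φ h
  | .inter _ _, h => by
    simp [CPDLTWProgram, PDLProgram.OK] at h
  | .cprog C xs xt, h => by
    simp only [CPDLTWProgram, PDLProgram.OK] at h ⊢
    obtain ⟨h1, h2, h3, ⟨H, hH, hi⟩, h5⟩ := h
    exact ⟨h1, h2, h3, ⟨H, tw_mono hH, hi⟩, mono_L C h5⟩
theorem mono_L : ∀ C : AtomList, AtomList.OK false false true (TWClass 1) C →
    AtomList.OK false false true (TWClass 2) C
  | .nil, _ => by simp [AtomList.OK]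
  | .acons π x y C, h => by
    simp only [AtomList.OK] at h ⊢
    exact ⟨mono_P π h.1, mono_L C h.2⟩
end

def LinTrans (k : ℕ) (F₁ F₂ : PDLFormula → Prop) (P₁ P₂ : PDLProgram → Prop) : Prop :=
  (∀ φ, F₁ φ → ∃ ψ, F₂ ψ ∧ FormEquiv φ ψ ∧ sizeOf ψ ≤ k * sizeOf φ) ∧
  (∀ π, P₁ π → ∃ ρ, P₂ ρ ∧ ProgEquiv π ρ ∧ sizeOf ρ ≤ k * sizeOf π)

theorem lin_bound (k n : ℕ) : k * n ≤ (n + (k + 2)) ^ (k + 2) := by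
  calc k * n ≤ (n + (k + 2)) * (n + (k + 2)) := Nat.mul_le_mul (by omega) (by omega)
    _ = (n + (k + 2)) ^ 2 := by ring
    _ ≤ _ := Nat.pow_le_pow_right (by omega) (by omega)

theorem LinTrans.poly {k : ℕ} {F₁ F₂ : PDLFormula → Prop} {P₁ P₂ : PDLProgram → Prop}
    (h : LinTrans k F₁ F₂ P₁ P₂) : PolyTrans F₁ F₂ P₁ P₂ := by
  classical
  obtain ⟨hF, hP⟩ := h
  refine ⟨fun φ => if h : F₁ φ then (hF φ h).choose else φ,
    fun π => if h : P₁ π then (hP π h).choose else π, k + 2, ?_, ?_⟩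
  · intro φ h
    simp only [h, dif_pos]
    obtain ⟨a, b, c⟩ := (hF φ h).choose_spec
    exact ⟨a, b, c.trans (lin_bound k _)⟩
  · intro φ h
    simp only [h, dif_pos]
    obtain ⟨a, b, c⟩ := (hP φ h).choose_spec
    exact ⟨a, b, c.trans (lin_bound k _)⟩

theorem LinTrans.comp {k l : ℕ} {F₁ F₂ F₃ : PDLFormula → Prop} {P₁ P₂ P₃ : PDLProgram → Prop}
    (h : LinTrans k F₁ F₂ P₁ P₂) (h' : LinTrans l F₂ F₃ P₂ P₃) :
    LinTrans (l * k) F₁ F₃ P₁ P₃ := by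
  constructor
  · intro φ hφ
    obtain ⟨ψ, a1, a2, a3⟩ := h.1 φ hφ
    obtain ⟨χ, b1, b2, b3⟩ := h'.1 ψ a1
    refine ⟨χ, b1, fun W K w => (a2 W K w).trans (b2 W K w), b3.trans ?_⟩
    rw [mul_assoc]; exact Nat.mul_le_mul_left _ a3
  · intro φ hφ
    obtain ⟨ψ, a1, a2, a3⟩ := h.2 φ hφ
    obtain ⟨χ, b1, b2, b3⟩ := h'.2 ψ a1
    refine ⟨χ, b1, fun W K u v => (a2 W K u v).trans (b2 W K u v), b3.trans ?_⟩
    rw [mul_assoc]; exact Nat.mul_le_mul_left _ a3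

/-- Theorem 1 of the paper: ICPDL, `CPDL(TW₁)` and `CPDL(TW₂)` are
equi-expressive, via polynomial-time translations. -/
theorem icpdl_tw1_tw2_equiexpressive :
    PolyTrans IsICPDLFormula (CPDLTWFormula 1) IsICPDLProgram (CPDLTWProgram 1) ∧
    PolyTrans (CPDLTWFormula 1) IsICPDLFormula (CPDLTWProgram 1) IsICPDLProgram ∧
    PolyTrans IsICPDLFormula (CPDLTWFormula 2) IsICPDLProgram (CPDLTWProgram 2) ∧
    PolyTrans (CPDLTWFormula 2) IsICPDLFormula (CPDLTWProgram 2) IsICPDLProgram ∧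
    PolyTrans (CPDLTWFormula 1) (CPDLTWFormula 2) (CPDLTWProgram 1) (CPDLTWProgram 2) ∧
    PolyTrans (CPDLTWFormula 2) (CPDLTWFormula 1) (CPDLTWProgram 2) (CPDLTWProgram 1) := by
  have hI1 : LinTrans 8 IsICPDLFormula (CPDLTWFormula 1) IsICPDLProgram (CPDLTWProgram 1) :=
    ⟨fromI_F, fromI_P⟩
  have h2I : LinTrans 8 (CPDLTWFormula 2) IsICPDLFormula (CPDLTWProgram 2) IsICPDLProgram :=
    ⟨toI_F, toI_P⟩
  have h12 : LinTrans 1 (CPDLTWFormula 1) (CPDLTWFormula 2) (CPDLTWProgram 1) (CPDLTWProgram 2) :=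
    ⟨fun φ h => ⟨φ, mono_F φ h, fun _ _ _ => Iff.rfl, by omega⟩,
     fun π h => ⟨π, mono_P π h, fun _ _ _ _ => Iff.rfl, by omega⟩⟩
  exact ⟨hI1.poly, (h12.comp h2I).poly, (hI1.comp h12).poly, h2I.poly, h12.poly,
    (h2I.comp hI1).poly⟩
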